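/- arXiv:math/0608611 — 11 statements merged into one kernel-verified Lean document; each statement's English description precedes it below -/
import Mathlib

section
/- Let J be a homogeneous ideal of ℂ[z_1,…,z_m] and let X = V(J) ⊆ ℂ^m. Let f_1,…,f_n ∈ ℂ[z_1,…,z_m] be homogeneous polynomials of degrees d_1,…,d_n whose only common zero on X is the origin, and let f be a homogeneous polynomial of degree d > max_i d_i. Then there exist continuous functions q_1,…,q_n : X → ℂ such that f(z) = q_1(z)f_1(z) + … + q_n(z)f_n(z) for all z ∈ X. -/
open MvPolynomial

/-- A homogeneous function of positive degree on a closed cone which is continuous away from the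
origin is continuous. -/
theorem continuousOn_of_homogeneous {E : Type*} [NormedAddCommGroup E] [NormedSpace ℝ E]
    [ProperSpace E] {X : Set E} (hX : IsClosed X) (hcone : ∀ z ∈ X, ∀ t : ℝ, t • z ∈ X)
    {q : E → ℂ} {k : ℕ} (hk : 0 < k) (hq : ∀ z (t : ℝ), 0 < t → q (t • z) = (t : ℂ) ^ k * q z)
    (hq0 : q 0 = 0) (hc : ContinuousOn q (X \ {0})) : ContinuousOn q X := by
  obtain ⟨C, hC⟩ := ((isCompact_sphere (0 : E) 1).inter_left hX).exists_bound_of_continuousOn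
    (hc.mono fun z hz ↦ ⟨hz.1, fun h ↦ by simp [Set.mem_singleton_iff.1 h] at hz⟩)
  have hbound : ∀ z ∈ X, ‖q z‖ ≤ ‖z‖ ^ k * C := by
    intro z hz
    rcases eq_or_ne z 0 with rfl | hz0
    · simp [hq0, hk.ne']
    have hpos : 0 < ‖z‖ := norm_pos_iff.2 hz0
    have hu := hC (‖z‖⁻¹ • z) ⟨hcone z hz _, by simp [norm_smul, hpos.ne']⟩
    have heq := hq (‖z‖⁻¹ • z) ‖z‖ hpos
    rw [smul_inv_smul₀ hpos.ne'] at heq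
    rw [heq, norm_mul, norm_pow, Complex.norm_real, norm_norm]
    gcongr
  intro z hz
  rcases eq_or_ne z 0 with rfl | hz0
  · have hlim : Filter.Tendsto (fun z : E ↦ ‖z‖ ^ k * C) (nhdsWithin 0 X) (nhds 0) := by
      have : Continuous fun z : E ↦ ‖z‖ ^ k * C := by fun_prop
      simpa [hk.ne'] using (this.tendsto 0).mono_left nhdsWithin_le_nhds
    rw [ContinuousWithinAt, hq0]
    exact squeeze_zero_norm' (Filter.eventually_of_mem self_mem_nhdsWithin hbound) hlim
  · refine (hc z ⟨hz, hz0⟩).mono_of_mem_nhdsWithin ?_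
    rw [Set.sdiff_eq]
    exact Filter.inter_mem self_mem_nhdsWithin
      (mem_nhdsWithin_of_mem_nhds (isOpen_compl_singleton.mem_nhds hz0))

/-- A homogeneous polynomial of degree `e` satisfies `p (c z) = c ^ e p z`. -/
theorem MvPolynomial.IsHomogeneous.eval_smul {σ R : Type*} [CommSemiring R]
    {p : MvPolynomial σ R} {e : ℕ} (hp : p.IsHomogeneous e) (c : R) (z : σ → R) :
    eval (c • z) p = c ^ e * eval z p := by
  rw [eval_eq, eval_eq, Finset.mul_sum]
  refine Finset.sum_congr rfl fun s hs ↦ ?_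
  have hdeg : ∑ i ∈ s.support, s i = e := by
    simpa [Finsupp.weight_apply, Finsupp.sum] using hp (mem_support_iff.1 hs)
  simp only [Pi.smul_apply, smul_eq_mul, mul_pow, Finset.prod_mul_distrib,
    Finset.prod_pow_eq_pow_sum, hdeg]
  ring

/-- The zero locus of an ideal generated by homogeneous polynomials is a cone. -/
theorem eval_smul_eq_zero_of_mem_span {σ R : Type*} [CommSemiring R] {S : Set (MvPolynomial σ R)}
    (hS : ∀ g ∈ S, ∃ e : ℕ, g.IsHomogeneous e) {z : σ → R}
    (hz : ∀ g ∈ Ideal.span S, eval z g = 0) (c : R) :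
    ∀ g ∈ Ideal.span S, eval (c • z) g = 0 := by
  have hle : Ideal.span S ≤ RingHom.ker (eval (c • z)) := by
    refine Ideal.span_le.2 fun g hg ↦ ?_
    obtain ⟨e, he⟩ := hS g hg
    simp [RingHom.mem_ker, he.eval_smul, hz g (Ideal.subset_span hg)]
  exact fun g hg ↦ hle hg

/-- Let `J` be a homogeneous ideal of `ℂ[z_1,…,z_m]` and `X = V(J) ⊆ ℂ^m`. Let
`f_1,…,f_n` be homogeneous polynomials of degrees `d_1,…,d_n` whose only common zero on `X`
is the origin, and let `f` be a homogeneous polynomial of degree `d > max_i d_i`. Then there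
exist continuous functions `q_1,…,q_n : X → ℂ` with `f = q_1 f_1 + … + q_n f_n` on `X`. -/
theorem stmt_0 (m : ℕ) (J : Ideal (MvPolynomial (Fin m) ℂ))
    (hJ : ∃ S : Set (MvPolynomial (Fin m) ℂ),
      (∀ g ∈ S, ∃ e : ℕ, g.IsHomogeneous e) ∧ J = Ideal.span S)
    (n : ℕ) (hn : 0 < n) (F : Fin n → MvPolynomial (Fin m) ℂ) (D : Fin n → ℕ)
    (hF : ∀ i, (F i).IsHomogeneous (D i))
    (hcz : ∀ z : Fin m → ℂ, (∀ g ∈ J, eval z g = 0) → (∀ i, eval z (F i) = 0) → z = 0)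
    (f : MvPolynomial (Fin m) ℂ) (d : ℕ) (hf : f.IsHomogeneous d) (hd : ∀ i, D i < d) :
    ∃ q : Fin n → ({z : Fin m → ℂ // ∀ g ∈ J, eval z g = 0} → ℂ),
      (∀ i, Continuous (q i)) ∧
      ∀ z : {z : Fin m → ℂ // ∀ g ∈ J, eval z g = 0},
        eval z.1 f = ∑ i, q i z * eval z.1 (F i) := by
  obtain ⟨S, hS, rfl⟩ := hJ
  set X : Set (Fin m → ℂ) := {z | ∀ g ∈ Ideal.span S, eval z g = 0} with hXdef
  have hXclosed : IsClosed X := by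
    simp only [hXdef, Set.ofPred_forall]
    exact isClosed_iInter fun g ↦ isClosed_iInter fun _ ↦
      isClosed_eq (MvPolynomial.continuous_eval g) continuous_const
  have hsmul (t : ℝ) (z : Fin m → ℂ) : t • z = (t : ℂ) • z := by
    ext; simp
  have hcone : ∀ z ∈ X, ∀ t : ℝ, t • z ∈ X := fun z hz t ↦ by
    rw [hsmul]
    exact eval_smul_eq_zero_of_mem_span hS hz t
  let w (i : Fin n) (z : Fin m → ℂ) : ℂ :=
    starRingEnd ℂ (eval z (F i)) * (‖z‖ : ℂ) ^ (2 * (d - D i))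
  let G (z : Fin m → ℂ) : ℂ := ∑ i, w i z * eval z (F i)
  let q (i : Fin n) (z : Fin m → ℂ) : ℂ := eval z f * w i z / G z
  have hw_smul (i) (z) (t : ℝ) (ht : 0 < t) :
      w i (t • z) = (t : ℂ) ^ (D i + 2 * (d - D i)) * w i z := by
    simp only [w, norm_smul, Real.norm_of_nonneg ht.le]
    rw [hsmul, (hF i).eval_smul]
    simp only [map_mul, map_pow, Complex.conj_ofReal, Complex.ofReal_mul]
    ring
  have hG_smul (z) (t : ℝ) (ht : 0 < t) : G (t • z) = (t : ℂ) ^ (2 * d) * G z := by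
    simp only [G, Finset.mul_sum]
    refine Finset.sum_congr rfl fun i _ ↦ ?_
    have hexp : 2 * d = D i + 2 * (d - D i) + D i := by have := hd i; omega
    rw [hw_smul i z t ht, hsmul, (hF i).eval_smul, hexp]
    ring
  have hq_smul (i) (z) (t : ℝ) (ht : 0 < t) :
      q i (t • z) = (t : ℂ) ^ (d - D i) * q i z := by
    have ht' : (t : ℂ) ^ (2 * d) ≠ 0 := pow_ne_zero _ (by exact_mod_cast ht.ne')
    have hexp : d + (D i + 2 * (d - D i)) = 2 * d + (d - D i) := by have := hd i; omega
    simp only [q]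
    rw [hw_smul i z t ht, hG_smul z t ht, hsmul, hf.eval_smul, mul_mul_mul_comm, ← pow_add, hexp,
      pow_add, mul_assoc, mul_div_mul_left _ _ ht', mul_div_assoc]
  have hd0 : d ≠ 0 := (Nat.zero_le _ |>.trans_lt (hd ⟨0, hn⟩)).ne'
  have hf0 : eval 0 f = 0 := by
    simpa [hd0] using hf.eval_smul 0 0
  have hG_ne : ∀ z ∈ X, z ≠ 0 → G z ≠ 0 := by
    intro z hz hz0 hG
    have hreal : G z = ((∑ i, ‖eval z (F i)‖ ^ 2 * ‖z‖ ^ (2 * (d - D i)) : ℝ) : ℂ) := by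
      simp only [G, w]
      push_cast
      refine Finset.sum_congr rfl fun i _ ↦ ?_
      rw [← Complex.conj_mul']
      ring
    rw [hreal, Complex.ofReal_eq_zero, Finset.sum_eq_zero_iff_of_nonneg fun i _ ↦ by positivity]
      at hG
    refine hz0 (hcz z hz fun i ↦ ?_)
    simpa [hz0] using hG i (Finset.mem_univ i)
  have hw_cont (i) : Continuous (w i) := by
    have := MvPolynomial.continuous_eval (F i)
    have := Complex.continuous_conj.comp this
    simp only [w]
    fun_prop
  have hG_cont : Continuous G :=
    continuous_finsetSum _ fun i _ ↦ (hw_cont i).mul (MvPolynomial.continuous_eval (F i))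
  refine ⟨fun i z ↦ q i z.1, fun i ↦ ?_, fun ⟨z, hz⟩ ↦ ?_⟩
  · refine (continuousOn_of_homogeneous hXclosed hcone (Nat.sub_pos_of_lt (hd i)) (hq_smul i)
      (by simp only [q, hf0, zero_mul, zero_div]) ?_).domRestrict
    exact (((MvPolynomial.continuous_eval f).mul (hw_cont i)).continuousOn).div
      hG_cont.continuousOn fun z hz ↦ hG_ne z hz.1 hz.2
  · rcases eq_or_ne z 0 with rfl | hz0
    · simp only [q, hf0, zero_mul, zero_div, Finset.sum_const_zero]
    · have hsum : ∑ i, q i z * eval z (F i) = eval z f / G z * G z := by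
        simp only [G, Finset.mul_sum, q]
        exact Finset.sum_congr rfl fun i _ ↦ by ring
      exact (hsum.trans (div_mul_cancel₀ _ (hG_ne z hz hz0))).symm
end

section
/- Let f ∈ ℂ[z_1,…,z_m] be a homogeneous polynomial of degree d ≥ 1. Then there exist continuous functions q_1,…,q_m : ℂ^m → ℂ such that f(z) = q_1(z)·z_1^{d-1} + … + q_m(z)·z_m^{d-1} for all z ∈ ℂ^m. -/
open MvPolynomial

/-- A homogeneous polynomial of degree `d` is bounded by a multiple of `‖z‖ ^ d`. -/
theorem MvPolynomial.IsHomogeneous.norm_eval_le {m d : ℕ} {f : MvPolynomial (Fin m) ℂ}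
    (hf : f.IsHomogeneous d) (z : Fin m → ℂ) :
    ‖eval z f‖ ≤ (∑ e ∈ f.support, ‖f.coeff e‖) * ‖z‖ ^ d := by
  rw [eval_eq', Finset.sum_mul]
  refine norm_sum_le_of_le _ fun e he => ?_
  have hdeg : ∑ i, e i = d := by
    rw [← Finsupp.degree_eq_sum, Finsupp.degree_eq_weight_one]
    exact hf (mem_support_iff.mp he)
  rw [norm_mul, norm_prod, ← hdeg, ← Finset.prod_pow_eq_pow_sum]
  gcongr with i
  rw [norm_pow]
  gcongr
  exact norm_le_pi_norm z i

/-- The sum of the `2n`-th powers of the moduli of the coordinates dominates the `2n`-th power of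
the sup norm. -/
theorem norm_pow_le_sum_norm_pow {m : ℕ} (n : ℕ) {z : Fin m → ℂ} (hz : z ≠ 0) :
    ‖z‖ ^ (2 * n) ≤ ∑ j, ‖z j‖ ^ (2 * n) := by
  obtain ⟨i, -⟩ := Function.ne_iff.mp hz
  have : Nonempty (Fin m) := ⟨i⟩
  obtain ⟨j, hj⟩ := Finite.exists_max fun j => ‖z j‖
  calc ‖z‖ ^ (2 * n) ≤ ‖z j‖ ^ (2 * n) := by
        gcongr
        exact (pi_norm_le_iff_of_nonempty z).mpr hj
    _ ≤ _ := Finset.single_le_sum (f := fun j => ‖z j‖ ^ (2 * n))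
        (fun _ _ => by positivity) (Finset.mem_univ j)

/-- Let `f ∈ ℂ[z_1,…,z_m]` be a homogeneous polynomial of degree `d ≥ 1`. Then there exist
continuous functions `q_1,…,q_m : ℂ^m → ℂ` such that
`f(z) = q_1(z)·z_1^(d-1) + … + q_m(z)·z_m^(d-1)` for all `z ∈ ℂ^m`. -/
theorem stmt_1 (m d : ℕ) (hd : 1 ≤ d) (f : MvPolynomial (Fin m) ℂ)
    (hf : f.IsHomogeneous d) :
    ∃ q : Fin m → ((Fin m → ℂ) → ℂ), (∀ i, Continuous (q i)) ∧
      ∀ z : Fin m → ℂ, eval z f = ∑ i, q i z * (z i) ^ (d - 1) := by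
  obtain ⟨n, rfl⟩ := Nat.exists_eq_add_of_le' hd
  simp only [Nat.add_sub_cancel]
  have f_zero : constantCoeff f = 0 := by
    simpa using hf.norm_eval_le 0
  let S : (Fin m → ℂ) → ℝ := fun z => ∑ j, ‖z j‖ ^ (2 * n)
  have S_pos {z : Fin m → ℂ} (hz : z ≠ 0) : 0 < S z :=
    (pow_pos (norm_pos_iff.mpr hz) _).trans_le (norm_pow_le_sum_norm_pow n hz)
  have S_cont : Continuous S := by fun_prop
  have f_cont : Continuous fun z => eval z f := MvPolynomial.continuous_eval f
  refine ⟨fun i z => eval z f * starRingEnd ℂ (z i ^ n) / (S z : ℂ), fun i => ?_, fun z => ?_⟩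
  · rw [continuous_iff_continuousAt]
    intro z
    rcases eq_or_ne z 0 with rfl | hz
    · set C := ∑ e ∈ f.support, ‖f.coeff e‖
      have bound (w : Fin m → ℂ) :
          ‖eval w f * starRingEnd ℂ (w i ^ n) / (S w : ℂ)‖ ≤ C * ‖w‖ := by
        rcases eq_or_ne w 0 with rfl | hw
        · simp [f_zero]
        · rw [norm_div, norm_mul, RCLike.norm_conj, norm_pow, Complex.norm_real,
            Real.norm_of_nonneg (S_pos hw).le, div_le_iff₀ (S_pos hw)]
          calc ‖eval w f‖ * ‖w i‖ ^ n ≤ C * ‖w‖ ^ (n + 1) * ‖w‖ ^ n := by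
                gcongr
                · exact hf.norm_eval_le w
                · exact norm_le_pi_norm w i
            _ = C * ‖w‖ * ‖w‖ ^ (2 * n) := by ring
            _ ≤ C * ‖w‖ * S w := by
                gcongr
                exact norm_pow_le_sum_norm_pow n hw
      have lim : Filter.Tendsto (fun w : Fin m → ℂ => C * ‖w‖) (nhds 0) (nhds 0) :=
        Continuous.tendsto' (by fun_prop) _ _ (by simp)
      simpa [ContinuousAt, f_zero] using squeeze_zero_norm bound lim
    · refine ContinuousAt.div ?_ (by fun_prop) (by exact_mod_cast (S_pos hz).ne')
      exact (f_cont.mul (Complex.continuous_conj.comp (by fun_prop))).continuousAt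
  · rcases eq_or_ne z 0 with rfl | hz
    · simp [f_zero]
    · have hS : (S z : ℂ) ≠ 0 := by exact_mod_cast (S_pos hz).ne'
      have term (i : Fin m) : eval z f * starRingEnd ℂ (z i ^ n) / (S z : ℂ) * z i ^ n =
          eval z f / (S z : ℂ) * ((‖z i‖ ^ (2 * n) : ℝ) : ℂ) := by
        have : starRingEnd ℂ (z i ^ n) * z i ^ n = ((‖z i‖ ^ (2 * n) : ℝ) : ℂ) := by
          rw [Complex.conj_mul', norm_pow]
          push_cast
          ring
        rw [← this]
        ring
      rw [Finset.sum_congr rfl fun i _ => term i, ← Finset.mul_sum, ← Complex.ofReal_sum,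
        div_mul_cancel₀ _ hS]
end

section
/- Let n < e be positive integers and k ≥ 1. Let M = {μ ∈ ℕ^k : μ_1 + … + μ_k = e} and let V = {(q, (a_μ)_{μ∈M}, y) ∈ ℂ × ℂ^M × ℂ^k : q^n = Σ_{μ∈M} a_μ · y_1^{μ_1}⋯y_k^{μ_k}}, equipped with the subspace topology. Then there exist continuous functions c_1,…,c_k : V → ℂ such that q = c_1(P)·y_1 + … + c_k(P)·y_k holds at every point P = (q, (a_μ), y) of V. -/
open Filter Topology

/-- The square of the sup norm of `z` is dominated by the sum of the squared norms. -/
lemma norm_sq_le_sum_norm_sq {ι : Type*} [Fintype ι] (z : ι → ℂ) :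
    ‖z‖ ^ 2 ≤ ∑ j, ‖z j‖ ^ 2 := by
  have hS : 0 ≤ ∑ j, ‖z j‖ ^ 2 := Finset.sum_nonneg fun j _ => sq_nonneg _
  refine (Real.le_sqrt (norm_nonneg z) hS).1 ((pi_norm_le_iff_of_nonneg (Real.sqrt_nonneg _)).2 ?_)
  exact fun i => Real.le_sqrt_of_sq_le
    (Finset.single_le_sum (f := fun j => ‖z j‖ ^ 2) (fun j _ => sq_nonneg _) (Finset.mem_univ i))

/-- If `‖q‖ ^ n` is dominated by a continuous function times `‖y‖ ^ e` with `n < e`, then `q` is a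
combination of the coordinates of `y` with continuous coefficients. -/
lemma exists_continuous_coeff_of_norm_pow_le {X ι : Type*} [TopologicalSpace X] [Fintype ι]
    {n e : ℕ} (hn : 0 < n) (hne : n < e) {q : X → ℂ} {y : X → ι → ℂ} {B : X → ℝ}
    (hq : Continuous q) (hy : Continuous y) (hB : Continuous B)
    (h : ∀ x, ‖q x‖ ^ n ≤ B x * ‖y x‖ ^ e) :
    ∃ c : ι → X → ℂ, (∀ i, Continuous (c i)) ∧ ∀ x, q x = ∑ i, c i x * y x i := by
  have hyi (i : ι) : Continuous fun x => y x i := (continuous_apply i).comp hy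
  set S : X → ℝ := fun x => ∑ j, ‖y x j‖ ^ 2 with hSdef
  have hSc : Continuous S := continuous_finsetSum _ fun j _ => (hyi j).norm.pow 2
  have hS (x : X) : ‖y x‖ ^ 2 ≤ S x := norm_sq_le_sum_norm_sq (y x)
  have hS0 {x : X} (hx : y x ≠ 0) : 0 < S x := (pow_pos (norm_pos_iff.2 hx) 2).trans_le (hS x)
  have hbound (i : ι) (x : X) (hx : y x ≠ 0) :
      ‖q x * star (y x i) / (S x : ℂ)‖ ≤ (B x * ‖y x‖ ^ (e - n)) ^ ((n : ℝ)⁻¹) := by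
    have hpos : 0 < ‖y x‖ := norm_pos_iff.2 hx
    have hle : ‖q x * star (y x i) / (S x : ℂ)‖ ≤ ‖q x‖ / ‖y x‖ := by
      rw [norm_div, norm_mul, norm_star, Complex.norm_real, Real.norm_of_nonneg (hS0 hx).le,
        div_le_div_iff₀ (hS0 hx) hpos, mul_assoc]
      gcongr
      calc ‖y x i‖ * ‖y x‖ ≤ ‖y x‖ * ‖y x‖ := by gcongr; exact norm_le_pi_norm _ i
        _ ≤ S x := by rw [← sq]; exact hS x
    have hpow : (‖q x‖ / ‖y x‖) ^ n ≤ B x * ‖y x‖ ^ (e - n) := by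
      rw [div_pow, div_le_iff₀ (pow_pos hpos n), mul_assoc, ← pow_add, Nat.sub_add_cancel hne.le]
      exact h x
    refine hle.trans ?_
    rw [← Real.pow_rpow_inv_natCast (div_nonneg (norm_nonneg (q x)) hpos.le) hn.ne']
    exact Real.rpow_le_rpow (by positivity) hpow (by positivity)
  refine ⟨fun i x => q x * star (y x i) / (S x : ℂ), fun i => ?_, fun x => ?_⟩
  · refine continuous_iff_continuousAt.2 fun x => ?_
    by_cases hx : y x = 0
    · have hz {x' : X} (hx' : y x' = 0) : q x' * star (y x' i) / (S x' : ℂ) = 0 := by simp [hx']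
      have hlim : Tendsto (fun x' => |(B x' * ‖y x'‖ ^ (e - n)) ^ ((n : ℝ)⁻¹)|) (𝓝 x) (𝓝 0) := by
        have hc : Continuous fun x' => |(B x' * ‖y x'‖ ^ (e - n)) ^ ((n : ℝ)⁻¹)| :=
          ((hB.mul (hy.norm.pow _)).rpow_const fun _ => Or.inr (by positivity)).abs
        convert hc.tendsto x using 2
        simp [hx, (Nat.sub_pos_of_lt hne).ne', Real.zero_rpow, hn.ne']
      change Tendsto _ _ (𝓝 (q x * star (y x i) / (S x : ℂ)))
      rw [hz hx]
      refine squeeze_zero_norm (fun x' => ?_) hlim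
      by_cases hx' : y x' = 0
      · simp only [hz hx', norm_zero]
        exact abs_nonneg _
      · exact (hbound i x' hx').trans (le_abs_self _)
    · exact ((hq.mul (hyi i).star).continuousAt).div
        (Complex.continuous_ofReal.comp hSc).continuousAt
        (Complex.ofReal_ne_zero.2 (hS0 hx).ne')
  · by_cases hx : y x = 0
    · have := h x
      rw [hx, norm_zero, zero_pow (hn.trans hne).ne', mul_zero] at this
      have hqx : q x = 0 := norm_eq_zero.1 <|
        eq_zero_of_pow_eq_zero (this.antisymm (by positivity))
      simp [hqx]
    · have hsum : ∑ i, star (y x i) * y x i = (S x : ℂ) := by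
        rw [hSdef, Complex.ofReal_sum]
        refine Finset.sum_congr rfl fun i _ => ?_
        rw [Complex.ofReal_pow]
        exact Complex.conj_mul' _
      have hne0 : (S x : ℂ) ≠ 0 := Complex.ofReal_ne_zero.2 (hS0 hx).ne'
      calc q x = q x / S x * ∑ i, star (y x i) * y x i := by rw [hsum, div_mul_cancel₀ _ hne0]
        _ = _ := by
          rw [Finset.mul_sum]
          exact Finset.sum_congr rfl fun i _ => by ring

/-- Let `n < e` be positive integers, `k ≥ 1`, `M` the set of multi-indices `μ ∈ ℕ^k` with
`|μ| = e` (encoded with entries in `Fin (e+1)`, which is no restriction since `μ_i ≤ e`), and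
`V ⊆ ℂ × ℂ^M × ℂ^k` the zero set of `q^n - Σ_{μ∈M} a_μ y^μ`. Then there are continuous
functions `c_1,…,c_k : V → ℂ` with `q = Σ_i c_i·y_i` on `V`. -/
theorem stmt_3 (n e k : ℕ) (hn : 0 < n) (hne : n < e) (hk : 1 ≤ k) :
    ∃ c : Fin k →
      ({P : ℂ × ({μ : Fin k → Fin (e + 1) // ∑ i, (μ i : ℕ) = e} → ℂ) × (Fin k → ℂ) //
        P.1 ^ n = ∑ μ : {μ : Fin k → Fin (e + 1) // ∑ i, (μ i : ℕ) = e},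
          P.2.1 μ * ∏ i, P.2.2 i ^ ((μ : Fin k → Fin (e + 1)) i : ℕ)} → ℂ),
      (∀ i, Continuous (c i)) ∧
      ∀ P : {P : ℂ × ({μ : Fin k → Fin (e + 1) // ∑ i, (μ i : ℕ) = e} → ℂ) × (Fin k → ℂ) //
        P.1 ^ n = ∑ μ : {μ : Fin k → Fin (e + 1) // ∑ i, (μ i : ℕ) = e},
          P.2.1 μ * ∏ i, P.2.2 i ^ ((μ : Fin k → Fin (e + 1)) i : ℕ)},
        P.1.1 = ∑ i, c i P * P.1.2.2 i := by
  refine exists_continuous_coeff_of_norm_pow_le (B := by exact fun P => ∑ μ, ‖P.1.2.1 μ‖) hn hne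
    (by fun_prop) (by fun_prop) (by fun_prop) fun P => ?_
  rw [← norm_pow, P.2, Finset.sum_mul]
  refine norm_sum_le_of_le _ fun μ _ => ?_
  rw [norm_mul, norm_prod]
  gcongr
  calc ∏ i, ‖P.1.2.2 i ^ (μ.1 i : ℕ)‖ ≤ ∏ i, ‖P.1.2.2‖ ^ (μ.1 i : ℕ) := by
        gcongr with i
        rw [norm_pow]
        gcongr
        exact norm_le_pi_norm _ i
    _ = ‖P.1.2.2‖ ^ e := by rw [Finset.prod_pow_eq_pow_sum, μ.2]
end

section
/- Let J ⊆ ℂ[z_1,…,z_m] be an ideal, let f, f_1,…,f_k ∈ ℂ[z_1,…,z_m], and suppose there exist natural numbers n < e such that f^n ∈ (f_1,…,f_k)^e + J (the e-th power of the ideal generated by f_1,…,f_k, plus J). Then there exist continuous functions q_1,…,q_k : V(J) → ℂ such that f(z) = q_1(z)f_1(z) + … + q_k(z)f_k(z) for all z ∈ V(J). -/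
open MvPolynomial

/-- The Euclidean norm of the vector of values of a family of polynomials. -/
noncomputable def evalNorm {m k : ℕ} (F : Fin k → MvPolynomial (Fin m) ℂ) (z : Fin m → ℂ) : ℝ :=
  √(∑ i, ‖eval z (F i)‖ ^ 2)

section evalNorm

variable {m k : ℕ} (F : Fin k → MvPolynomial (Fin m) ℂ)

lemma evalNorm_nonneg (z : Fin m → ℂ) : 0 ≤ evalNorm F z := Real.sqrt_nonneg _

lemma evalNorm_sq (z : Fin m → ℂ) : evalNorm F z ^ 2 = ∑ i, ‖eval z (F i)‖ ^ 2 :=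
  Real.sq_sqrt (by positivity)

lemma continuous_evalNorm : Continuous (evalNorm F) := by
  unfold evalNorm
  have h (i : Fin k) : Continuous fun z => eval z (F i) := MvPolynomial.continuous_eval (F i)
  fun_prop

lemma norm_eval_le_evalNorm (i : Fin k) (z : Fin m → ℂ) : ‖eval z (F i)‖ ≤ evalNorm F z :=
  Real.le_sqrt_of_sq_le <| Finset.single_le_sum (f := fun i => ‖eval z (F i)‖ ^ 2)
    (fun _ _ => by positivity) (Finset.mem_univ i)

/-- The polynomials bounded by a continuous multiple of the `e`-th power of `evalNorm F`. -/
def evalNormIdeal (e : ℕ) : Ideal (MvPolynomial (Fin m) ℂ) where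
  carrier := {g | ∃ C : (Fin m → ℂ) → ℝ, Continuous C ∧ (∀ z, 0 ≤ C z) ∧
    ∀ z, ‖eval z g‖ ≤ C z * evalNorm F z ^ e}
  zero_mem' := ⟨0, continuous_const, fun _ => le_rfl, fun z => by simp⟩
  add_mem' := by
    rintro a b ⟨C, hC, hC0, ha⟩ ⟨D, hD, hD0, hb⟩
    refine ⟨fun z => C z + D z, hC.add hD, fun z => add_nonneg (hC0 z) (hD0 z), fun z => ?_⟩
    rw [map_add, add_mul]
    exact (norm_add_le _ _).trans (add_le_add (ha z) (hb z))
  smul_mem' := by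
    rintro c a ⟨C, hC, hC0, ha⟩
    refine ⟨fun z => ‖eval z c‖ * C z, (MvPolynomial.continuous_eval c).norm.mul hC,
      fun z => mul_nonneg (norm_nonneg _) (hC0 z), fun z => ?_⟩
    rw [smul_eq_mul, map_mul, norm_mul, mul_assoc]
    exact mul_le_mul_of_nonneg_left (ha z) (norm_nonneg _)

lemma span_pow_le_evalNormIdeal (e : ℕ) :
    Ideal.span (Set.range F) ^ e ≤ evalNormIdeal F e := by
  induction e with
  | zero =>
    rw [pow_zero, Ideal.one_eq_top, top_le_iff, Ideal.eq_top_iff_one]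
    exact ⟨1, continuous_const, fun _ => zero_le_one, fun z => by simp⟩
  | succ e ih =>
    have hspan : Ideal.span (Set.range F) ≤ evalNormIdeal F 1 := by
      rw [Ideal.span_le]
      rintro _ ⟨i, rfl⟩
      exact ⟨1, continuous_const, fun _ => zero_le_one,
        fun z => by simpa using norm_eval_le_evalNorm F i z⟩
    rw [pow_succ, Ideal.mul_le]
    intro a ha b hb
    obtain ⟨C, hC, hC0, hCa⟩ := ih ha
    obtain ⟨D, hD, hD0, hDb⟩ := hspan hb
    refine ⟨fun z => C z * D z, hC.mul hD, fun z => mul_nonneg (hC0 z) (hD0 z), fun z => ?_⟩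
    rw [map_mul, norm_mul]
    calc ‖eval z a‖ * ‖eval z b‖
        ≤ (C z * evalNorm F z ^ e) * (D z * evalNorm F z ^ 1) :=
          mul_le_mul (hCa z) (hDb z) (norm_nonneg _)
            (mul_nonneg (hC0 z) (pow_nonneg (evalNorm_nonneg F z) e))
      _ = C z * D z * evalNorm F z ^ (e + 1) := by ring

end evalNorm

/-- If `f^n ∈ (f_1,…,f_k)^e + J` for some `n < e`, then the forcing equation
`f = Σ q_i f_i` has a continuous solution on `V(J)`. -/
theorem stmt_4 (m k : ℕ) (J : Ideal (MvPolynomial (Fin m) ℂ))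
    (f : MvPolynomial (Fin m) ℂ) (F : Fin k → MvPolynomial (Fin m) ℂ)
    (n e : ℕ) (hne : n < e)
    (hf : f ^ n ∈ (Ideal.span (Set.range F)) ^ e + J) :
    ∃ q : Fin k → ({z : Fin m → ℂ // ∀ g ∈ J, eval z g = 0} → ℂ),
      (∀ i, Continuous (q i)) ∧
      ∀ z : {z : Fin m → ℂ // ∀ g ∈ J, eval z g = 0},
        eval z.1 f = ∑ i, q i z * eval z.1 (F i) := by
  obtain ⟨g, hg, j, hj, hgj⟩ := Submodule.mem_sup.1 hf
  obtain ⟨C, hC, -, hCg⟩ := span_pow_le_evalNormIdeal F e hg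
  have hbound (z : {z : Fin m → ℂ // ∀ g ∈ J, eval z g = 0}) :
      ‖eval z.1 f‖ ^ n ≤ C z.1 * evalNorm F z.1 ^ e := by
    rw [← norm_pow, ← map_pow, ← hgj, map_add, z.2 j hj, add_zero]
    exact hCg z.1
  have hzero (z : {z : Fin m → ℂ // ∀ g ∈ J, eval z g = 0}) (hz : evalNorm F z.1 = 0) :
      eval z.1 f = 0 := by
    have h := hbound z
    rw [hz, zero_pow (by omega), mul_zero] at h
    exact norm_eq_zero.1 (eq_zero_of_pow_eq_zero (h.antisymm (by positivity)))
  let q (i : Fin k) (z : {z : Fin m → ℂ // ∀ g ∈ J, eval z g = 0}) : ℂ :=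
    eval z.1 f * star (eval z.1 (F i)) / ((evalNorm F z.1 ^ 2 : ℝ) : ℂ)
  have hcont (p : MvPolynomial (Fin m) ℂ) :
      Continuous fun z : {z : Fin m → ℂ // ∀ g ∈ J, eval z g = 0} => eval z.1 p :=
    (MvPolynomial.continuous_eval p).comp continuous_subtype_val
  have hN : Continuous fun z : {z : Fin m → ℂ // ∀ g ∈ J, eval z g = 0} => evalNorm F z.1 :=
    (continuous_evalNorm F).comp continuous_subtype_val
  have hq (i : Fin k) (z : {z : Fin m → ℂ // ∀ g ∈ J, eval z g = 0})
      (hz : evalNorm F z.1 ≠ 0) : ‖q i z‖ ^ n ≤ C z.1 * evalNorm F z.1 ^ (e - n) := by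
    have hpos : 0 < evalNorm F z.1 := (evalNorm_nonneg F z.1).lt_of_ne' hz
    have h1 : ‖q i z‖ ≤ ‖eval z.1 f‖ / evalNorm F z.1 := by
      simp only [q, norm_div, norm_mul, norm_star, Complex.norm_real, norm_pow,
        Real.norm_of_nonneg hpos.le]
      rw [div_le_div_iff₀ (by positivity) hpos, pow_two, mul_assoc]
      gcongr
      exact norm_eval_le_evalNorm F i z.1
    calc ‖q i z‖ ^ n ≤ (‖eval z.1 f‖ / evalNorm F z.1) ^ n := by gcongr
      _ = ‖eval z.1 f‖ ^ n / evalNorm F z.1 ^ n := div_pow _ _ _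
      _ ≤ C z.1 * evalNorm F z.1 ^ (e - n) := by
        rw [div_le_iff₀ (by positivity), mul_assoc, ← pow_add, Nat.sub_add_cancel hne.le]
        exact hbound z
  refine ⟨q, fun i => continuous_iff_continuousAt.2 fun z => ?_, fun z => ?_⟩
  · by_cases hz : evalNorm F z.1 = 0
    · have hqz : q i z = 0 := by simp [q, hz]
      rw [ContinuousAt, hqz, Metric.tendsto_nhds]
      intro ε hε
      have hlim : Filter.Tendsto (fun w : {z : Fin m → ℂ // ∀ g ∈ J, eval z g = 0} =>
          C w.1 * evalNorm F w.1 ^ (e - n)) (nhds z) (nhds 0) := by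
        have h : Continuous fun w : {z : Fin m → ℂ // ∀ g ∈ J, eval z g = 0} =>
            C w.1 * evalNorm F w.1 ^ (e - n) :=
          (hC.comp continuous_subtype_val).mul (hN.pow (e - n))
        simpa [hz, zero_pow (Nat.sub_pos_of_lt hne).ne'] using h.tendsto z
      filter_upwards [hlim.eventually_lt_const (pow_pos hε n)] with w hw
      rw [dist_zero_right]
      by_cases hw0 : evalNorm F w.1 = 0
      · simpa [q, hw0] using hε
      · exact lt_of_pow_lt_pow_left₀ n hε.le ((hq i w hw0).trans_lt hw)
    · refine ContinuousAt.div ((hcont f).mul (hcont (F i)).star).continuousAt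
        (Complex.continuous_ofReal.comp (hN.pow 2)).continuousAt ?_
      simpa using hz
  · by_cases hz : evalNorm F z.1 = 0
    · simp [q, hz, hzero z hz]
    · have hz' : ((evalNorm F z.1 ^ 2 : ℝ) : ℂ) ≠ 0 := by simpa using hz
      have hsum : ∑ i, q i z * eval z.1 (F i) =
          eval z.1 f * (∑ i, star (eval z.1 (F i)) * eval z.1 (F i)) /
            ((evalNorm F z.1 ^ 2 : ℝ) : ℂ) := by
        rw [Finset.mul_sum, Finset.sum_div]
        exact Finset.sum_congr rfl fun i _ => by simp only [q]; ring
      have hS : ∑ i, star (eval z.1 (F i)) * eval z.1 (F i) =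
          ((evalNorm F z.1 ^ 2 : ℝ) : ℂ) := by
        rw [evalNorm_sq, Complex.ofReal_sum]
        exact Finset.sum_congr rfl fun i _ => by
          rw [Complex.ofReal_pow]; exact Complex.conj_mul' _
      rw [hsum, hS, mul_div_cancel_right₀ _ hz']
end

section
/- Let X be a topological space and let f, f_1,…,f_k be continuous ℂ-valued functions on X. If there exist natural numbers n < e such that f^n belongs to the e-th power of the ideal generated by f_1,…,f_k in the ring C(X, ℂ) of continuous ℂ-valued functions on X, then f already belongs to the ideal generated by f_1,…,f_k in C(X, ℂ). -/
/-- Elements of the `m`-th power of an ideal are dominated by `s ^ m`, up to a continuous factor,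
when `s` dominates the generators. -/
theorem exists_norm_le_mul_pow_of_mem_span_pow {X : Type*} [TopologicalSpace X]
    {S : Set C(X, ℂ)} (s : C(X, ℝ)) (hs : ∀ a ∈ S, ∀ x, ‖a x‖ ≤ s x) (hs0 : ∀ x, 0 ≤ s x)
    (m : ℕ) {p : C(X, ℂ)} (hp : p ∈ Ideal.span S ^ m) :
    ∃ H : C(X, ℝ), ∀ x, 0 ≤ H x ∧ ‖p x‖ ≤ H x * s x ^ m := by
  have norm_cont (a : C(X, ℂ)) : Continuous fun x ↦ ‖a x‖ := a.continuous.norm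
  have key : ∀ b ∈ Ideal.span S, ∃ H : C(X, ℝ), ∀ x, 0 ≤ H x ∧ ‖b x‖ ≤ H x * s x := by
    intro b hb
    induction hb using Submodule.span_induction with
    | mem b hb => exact ⟨1, fun x ↦ ⟨by simp, by simpa using hs b hb x⟩⟩
    | zero => exact ⟨0, fun x ↦ by simp⟩
    | add a b _ _ ha hb =>
      obtain ⟨A, hA⟩ := ha
      obtain ⟨B, hB⟩ := hb
      refine ⟨A + B, fun x ↦ ⟨add_nonneg (hA x).1 (hB x).1, ?_⟩⟩
      have h := norm_add_le (a x) (b x)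
      simp only [ContinuousMap.add_apply]
      linarith [(hA x).2, (hB x).2]
    | smul c b _ hb =>
      obtain ⟨B, hB⟩ := hb
      refine ⟨⟨_, norm_cont c⟩ * B, fun x ↦ ⟨mul_nonneg (norm_nonneg (c x)) (hB x).1, ?_⟩⟩
      simp only [smul_eq_mul, ContinuousMap.mul_apply, norm_mul, ContinuousMap.coe_mk, mul_assoc]
      exact mul_le_mul_of_nonneg_left (hB x).2 (norm_nonneg _)
  induction m generalizing p with
  | zero => exact ⟨⟨_, norm_cont p⟩, fun x ↦ by simp⟩
  | succ m ih =>
    rw [Submodule.pow_succ] at hp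
    induction hp using Submodule.mul_induction_on' with
    | mem_mul_mem a ha b hb =>
      obtain ⟨A, hA⟩ := ih ha
      obtain ⟨B, hB⟩ := key b hb
      refine ⟨A * B, fun x ↦ ⟨mul_nonneg (hA x).1 (hB x).1, ?_⟩⟩
      calc ‖(a * b) x‖ = ‖a x‖ * ‖b x‖ := by simp
        _ ≤ (A x * s x ^ m) * (B x * s x) :=
          mul_le_mul (hA x).2 (hB x).2 (norm_nonneg _)
            (mul_nonneg (hA x).1 (pow_nonneg (hs0 x) m))
        _ = (A * B) x * s x ^ (m + 1) := by simp only [ContinuousMap.mul_apply]; ring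
    | add a _ b _ ha hb =>
      obtain ⟨A, hA⟩ := ha
      obtain ⟨B, hB⟩ := hb
      refine ⟨A + B, fun x ↦ ⟨add_nonneg (hA x).1 (hB x).1, ?_⟩⟩
      have h := norm_add_le (a x) (b x)
      simp only [ContinuousMap.add_apply, add_mul]
      linarith [(hA x).2, (hB x).2]

/-- If `|f| ^ n ≤ H s ^ (n + 1)` and `|a| ≤ s`, then `f * conj a / s ^ 2` (extended by zero) is
continuous. -/
theorem continuous_mul_conj_div_sq {X : Type*} [TopologicalSpace X] (f a : C(X, ℂ))
    (s H : C(X, ℝ)) (ha : ∀ x, ‖a x‖ ≤ s x) (n : ℕ) (hn : n ≠ 0)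
    (hH : ∀ x, 0 ≤ H x ∧ ‖f x‖ ^ n ≤ H x * s x ^ (n + 1)) :
    Continuous fun x ↦ f x * (starRingEnd ℂ) (a x) / (s x : ℂ) ^ 2 := by
  rw [continuous_iff_continuousAt]
  intro x
  have hs0 (y : X) : 0 ≤ s y := (norm_nonneg _).trans (ha y)
  by_cases hx : s x = 0
  · have bound (y : X) : ‖f y * (starRingEnd ℂ) (a y) / (s y : ℂ) ^ 2‖ ^ n ≤ H y * s y := by
      rcases (hs0 y).eq_or_lt with hy | hy
      · simp [← hy, hn]
      · have h1 : ‖f y * (starRingEnd ℂ) (a y) / (s y : ℂ) ^ 2‖ ≤ ‖f y‖ / s y := by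
          rw [norm_div, norm_mul, norm_pow, RCLike.norm_conj, Complex.norm_real,
            Real.norm_of_nonneg hy.le, div_le_div_iff₀ (by positivity) hy]
          calc ‖f y‖ * ‖a y‖ * s y ≤ ‖f y‖ * s y * s y := by gcongr; exact ha y
            _ = ‖f y‖ * s y ^ 2 := by ring
        calc _ ≤ (‖f y‖ / s y) ^ n := by gcongr
          _ ≤ H y * s y := by
            rw [div_pow, div_le_iff₀ (by positivity)]
            exact (hH y).2.trans_eq (by ring)
    have lim : Filter.Tendsto (fun y ↦ H y * s y) (nhds x) (nhds 0) := by
      have h : Continuous fun y ↦ H y * s y := by fun_prop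
      simpa [hx] using h.tendsto x
    simp only [ContinuousAt, hx, Complex.ofReal_zero, ne_eq, OfNat.ofNat_ne_zero,
      not_false_eq_true, zero_pow, div_zero]
    rw [Metric.tendsto_nhds]
    intro ε hε
    filter_upwards [lim.eventually_lt_const (pow_pos hε n)] with y hy
    rw [dist_zero_right]
    exact lt_of_pow_lt_pow_left₀ n hε.le ((bound y).trans_lt hy)
  · refine ContinuousAt.div ?_ ?_ (by simpa using hx)
    · have h : Continuous fun x ↦ f x * (starRingEnd ℂ) (a x) := by fun_prop
      exact h.continuousAt
    · have h : Continuous fun x ↦ (s x : ℂ) ^ 2 := by fun_prop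
      exact h.continuousAt

set_option synthInstance.maxHeartbeats 1000000 in
/-- Topological analogue: if `X` is a topological space, `f, f_1,…,f_k ∈ C(X,ℂ)` and
`f^n ∈ (f_1,…,f_k)^e` in `C(X,ℂ)` for some `n < e`, then `f ∈ (f_1,…,f_k)`. -/
theorem stmt_5 (X : Type*) [TopologicalSpace X] (k : ℕ)
    (f : C(X, ℂ)) (F : Fin k → C(X, ℂ)) (n e : ℕ) (hne : n < e)
    (hf : f ^ n ∈ (Ideal.span (Set.range F) : Ideal C(X, ℂ)) ^ e) :
    f ∈ Ideal.span (Set.range F) := by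
  have hf' := Ideal.pow_le_pow_right (Nat.succ_le_of_lt hne) hf
  rcases eq_or_ne n 0 with rfl | hn
  · rw [pow_zero, Nat.succ_eq_add_one, zero_add, Submodule.pow_one] at hf'
    simpa using Ideal.mul_mem_left _ f hf'
  let s : C(X, ℝ) := ⟨fun x ↦ √(∑ i, ‖F i x‖ ^ 2), by fun_prop⟩
  have hs2 (x : X) : s x ^ 2 = ∑ i, ‖F i x‖ ^ 2 :=
    Real.sq_sqrt (Finset.sum_nonneg fun i _ ↦ by positivity)
  have hFs (i : Fin k) (x : X) : ‖F i x‖ ≤ s x :=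
    Real.le_sqrt_of_sq_le
      (Finset.single_le_sum (f := fun i ↦ ‖F i x‖ ^ 2) (fun i _ ↦ by positivity)
        (Finset.mem_univ i))
  obtain ⟨H, hH⟩ := exists_norm_le_mul_pow_of_mem_span_pow s
    (by rintro _ ⟨i, rfl⟩; exact hFs i) (fun x ↦ Real.sqrt_nonneg _) _ hf'
  have hH' (x : X) : 0 ≤ H x ∧ ‖f x‖ ^ n ≤ H x * s x ^ (n + 1) := by simpa using hH x
  let g (i : Fin k) : C(X, ℂ) := ⟨_, continuous_mul_conj_div_sq f (F i) s H (hFs i) n hn hH'⟩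
  have hfg : f = ∑ i, g i * F i := by
    ext x
    have hsum : ∑ i, (starRingEnd ℂ) (F i x) * F i x = (s x : ℂ) ^ 2 := by
      simp only [Complex.conj_mul']
      exact_mod_cast (hs2 x).symm
    have hg : (∑ i, g i * F i) x
        = f x / (s x : ℂ) ^ 2 * ∑ i, (starRingEnd ℂ) (F i x) * F i x := by
      rw [ContinuousMap.sum_apply, Finset.mul_sum]
      refine Finset.sum_congr rfl fun i _ ↦ ?_
      simp only [g, ContinuousMap.mul_apply, ContinuousMap.coe_mk]
      ring
    rw [hg, hsum]
    by_cases hx : s x = 0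
    · have h := (hH' x).2
      rw [hx, zero_pow n.succ_ne_zero, mul_zero] at h
      have h0 : ‖f x‖ = 0 := eq_zero_of_pow_eq_zero (h.antisymm (by positivity))
      simp [norm_eq_zero.mp h0]
    · exact (div_mul_cancel₀ _ (by simpa using hx)).symm
  rw [hfg]
  exact Ideal.sum_mem _ fun i _ ↦
    Ideal.mul_mem_left _ _ (Ideal.subset_span (Set.mem_range_self i))
end

section
/- Let e, r, s be natural numbers with r < e, s < e and r + s > e. Then there exist continuous functions q_1, q_2 : ℂ^2 → ℂ such that z^r w^s = q_1(z,w)·z^e + q_2(z,w)·w^e for all (z,w) ∈ ℂ^2. -/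
lemma norm_pow_le_add_norm_pow (p : ℂ × ℂ) (n : ℕ) :
    ‖p‖ ^ n ≤ ‖p.1‖ ^ n + ‖p.2‖ ^ n := by
  have h1 : 0 ≤ ‖p.1‖ ^ n := by positivity
  have h2 : 0 ≤ ‖p.2‖ ^ n := by positivity
  rcases max_choice ‖p.1‖ ‖p.2‖ with h | h <;> rw [Prod.norm_def, h] <;> linarith

/-- A quotient of a monomial of degree `r + s` times a function of growth `‖p‖ ^ e`
by `‖z‖ ^ (2 * e) + ‖w‖ ^ (2 * e)` is continuous as soon as `e < r + s`. -/
lemma continuous_monomial_mul_div {e r s : ℕ} (he : 0 < e) (hrs : e < r + s) {g : ℂ × ℂ → ℂ}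
    (hg : Continuous g) (hge : ∀ p, ‖g p‖ ≤ ‖p‖ ^ e) :
    Continuous fun p : ℂ × ℂ ↦
      p.1 ^ r * p.2 ^ s * g p / ((‖p.1‖ ^ (2 * e) + ‖p.2‖ ^ (2 * e) : ℝ) : ℂ) := by
  obtain ⟨k, hk⟩ := Nat.exists_eq_add_of_lt hrs
  rw [continuous_iff_continuousAt]
  intro p
  by_cases hp : p = 0
  · subst hp
    have hbound : ∀ p : ℂ × ℂ,
        ‖p.1 ^ r * p.2 ^ s * g p / ((‖p.1‖ ^ (2 * e) + ‖p.2‖ ^ (2 * e) : ℝ) : ℂ)‖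
          ≤ ‖p‖ ^ (k + 1) := by
      intro p
      have hD := norm_pow_le_add_norm_pow p (2 * e)
      rw [norm_div, Complex.norm_real, Real.norm_of_nonneg (by positivity), norm_mul, norm_mul,
        norm_pow, norm_pow]
      refine div_le_of_le_mul₀ (by positivity) (by positivity) ?_
      calc ‖p.1‖ ^ r * ‖p.2‖ ^ s * ‖g p‖ ≤ ‖p‖ ^ r * ‖p‖ ^ s * ‖p‖ ^ e := by
            gcongr
            · exact norm_fst_le p
            · exact norm_snd_le p
            · exact hge p
        _ = ‖p‖ ^ (k + 1) * ‖p‖ ^ (2 * e) := by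
            rw [← pow_add, ← pow_add, ← pow_add]
            congr 1
            lia
        _ ≤ _ := by gcongr
    have hlim : Filter.Tendsto (fun p : ℂ × ℂ ↦ ‖p‖ ^ (k + 1)) (nhds 0) (nhds 0) := by
      have : Continuous fun p : ℂ × ℂ ↦ ‖p‖ ^ (k + 1) := by fun_prop
      simpa using this.tendsto 0
    have he' : 2 * e ≠ 0 := by lia
    simpa [ContinuousAt, he'] using squeeze_zero_norm hbound hlim
  · refine ContinuousAt.div (by fun_prop) (by fun_prop) ?_
    have hpos : 0 < ‖p‖ ^ (2 * e) := pow_pos (norm_pos_iff.2 hp) _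
    exact_mod_cast (hpos.trans_le (norm_pow_le_add_norm_pow p (2 * e))).ne'

/-- For natural numbers `r, s < e` with `r + s > e` there exist continuous functions
`q_1, q_2 : ℂ² → ℂ` with `z^r w^s = q_1(z,w) z^e + q_2(z,w) w^e`. -/
theorem stmt_7 (e r s : ℕ) (hr : r < e) (hs : s < e) (hrs : e < r + s) :
    ∃ q₁ q₂ : ℂ × ℂ → ℂ, Continuous q₁ ∧ Continuous q₂ ∧
      ∀ z w : ℂ, z ^ r * w ^ s = q₁ (z, w) * z ^ e + q₂ (z, w) * w ^ e := by
  have he : 0 < e := by lia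
  refine ⟨_, _,
    continuous_monomial_mul_div he hrs (g := fun p ↦ (starRingEnd ℂ p.1) ^ e)
      (by fun_prop) fun p ↦ ?_,
    continuous_monomial_mul_div he hrs (g := fun p ↦ (starRingEnd ℂ p.2) ^ e)
      (by fun_prop) fun p ↦ ?_, fun z w ↦ ?_⟩
  · rw [norm_pow, RCLike.norm_conj]
    gcongr
    exact norm_fst_le p
  · rw [norm_pow, RCLike.norm_conj]
    gcongr
    exact norm_snd_le p
  · have hconj (x : ℂ) : (starRingEnd ℂ x) ^ e * x ^ e = (‖x‖ : ℂ) ^ (2 * e) := by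
      rw [← mul_pow, Complex.conj_mul', ← pow_mul]
    by_cases h : (z, w) = (0 : ℂ × ℂ)
    · obtain ⟨rfl, rfl⟩ := Prod.mk.inj h
      have hr0 : r ≠ 0 := by lia
      simp [hr0]
    · have hpos : 0 < ‖(z, w)‖ ^ (2 * e) := pow_pos (norm_pos_iff.2 h) _
      have hD : ((‖z‖ ^ (2 * e) + ‖w‖ ^ (2 * e) : ℝ) : ℂ) ≠ 0 := by
        exact_mod_cast (hpos.trans_le (norm_pow_le_add_norm_pow (z, w) (2 * e))).ne'
      dsimp only
      rw [div_mul_eq_mul_div, div_mul_eq_mul_div, ← add_div, eq_div_iff hD]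
      push_cast
      rw [← hconj, ← hconj]
      ring
end

section
/- Let X_n = {z ∈ ℂ^n : z_i z_j = 0 for all i ≠ j} be the union of the coordinate axes in ℂ^n, with the subspace topology. Let f, f_1,…,f_k ∈ ℂ[x_1,…,x_n] and suppose there exist continuous functions q_1,…,q_k : X_n → ℂ such that f(z) = q_1(z)f_1(z) + … + q_k(z)f_k(z) for all z ∈ X_n. Then f belongs to the ideal (f_1,…,f_k) + (x_i x_j : i ≠ j) of ℂ[x_1,…,x_n]; that is, the image of f in the ring of axes ℂ[x_1,…,x_n]/(x_i x_j : i ≠ j) lies in the ideal generated by the images of f_1,…,f_k. (On a scheme of axes the continuous closure of an ideal equals the ideal.) -/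
open MvPolynomial

/-- If a polynomial `p` is pointwise a nonzero polynomial `g` times a continuous function `s`,
then `s` is itself a polynomial function. -/
theorem exists_polynomial_eq_of_continuous_quotient {s : ℂ → ℂ} (hs : Continuous s) (d : ℕ) :
    ∀ g p : Polynomial ℂ, g ≠ 0 → g.natDegree = d → (∀ t, p.eval t = g.eval t * s t) →
      ∃ r : Polynomial ℂ, ∀ t, r.eval t = s t := by
  induction d with
  | zero =>
    intro g p hg hd h
    obtain ⟨c, rfl⟩ := Polynomial.natDegree_eq_zero.1 hd
    have hc : c ≠ 0 := by rintro rfl; simp at hg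
    refine ⟨Polynomial.C c⁻¹ * p, fun t => ?_⟩
    simp [h, hc]
  | succ d ih =>
    intro g p hg hd h
    obtain ⟨a, ha⟩ := IsAlgClosed.exists_root g (by
      rw [Polynomial.degree_eq_natDegree hg, hd]; exact_mod_cast d.succ_ne_zero)
    obtain ⟨g', rfl⟩ := Polynomial.dvd_iff_isRoot.2 ha
    have hpa : p.IsRoot a := by simp [Polynomial.IsRoot, h]
    obtain ⟨p', rfl⟩ := Polynomial.dvd_iff_isRoot.2 hpa
    have hg' : g' ≠ 0 := right_ne_zero_of_mul hg
    refine ih g' p' hg' ?_ ?_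
    · rw [Polynomial.natDegree_mul (Polynomial.X_sub_C_ne_zero a) hg',
        Polynomial.natDegree_X_sub_C] at hd
      omega
    · have hdense : Dense ({a}ᶜ : Set ℂ) := dense_compl_singleton a
      have hcont : Continuous fun t => g'.eval t * s t := g'.continuous.mul hs
      refine fun t => congrFun (p'.continuous.ext_on hdense hcont fun x hx => ?_) t
      have hx' : x - a ≠ 0 := sub_ne_zero.2 hx
      have := h x
      simp only [Polynomial.eval_mul, Polynomial.eval_sub, Polynomial.eval_X,
        Polynomial.eval_C, mul_assoc] at this
      exact mul_left_cancel₀ hx' this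

/-- A polynomial that is a combination of polynomials `G j` with continuous coefficients vanishing
at `0` is a combination with polynomial coefficients vanishing at `0`. -/
theorem exists_polynomial_coeffs {ι : Type*} [Fintype ι] (G : ι → Polynomial ℂ)
    (p : Polynomial ℂ) (h : ι → ℂ → ℂ) (hc : ∀ j, Continuous (h j)) (h0 : ∀ j, h j 0 = 0)
    (hp : ∀ t, p.eval t = ∑ j, h j t * (G j).eval t) :
    ∃ a : ι → Polynomial ℂ, p = ∑ j, Polynomial.X * a j * G j := by
  obtain ⟨g, hg⟩ := (IsPrincipalIdealRing.principal (Ideal.span (Set.range G))).principal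
  replace hg : Ideal.span (Set.range G) = Ideal.span {g} := hg
  have hdvd : ∀ j, ∃ b, G j = g * b := fun j =>
    Ideal.mem_span_singleton.1 (hg ▸ Ideal.subset_span ⟨j, rfl⟩)
  choose b hb using hdvd
  have hmem : g ∈ Ideal.span (Set.range G) := hg ▸ Ideal.mem_span_singleton_self g
  obtain ⟨c, hcg⟩ := Ideal.mem_span_range_iff_exists_fun.1 hmem
  have hps : ∀ t, p.eval t = g.eval t * ∑ j, h j t * (b j).eval t := fun t => by
    rw [hp, Finset.mul_sum]
    refine Finset.sum_congr rfl fun j _ => ?_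
    rw [hb j, Polynomial.eval_mul]
    ring
  by_cases hg0 : g = 0
  · refine ⟨0, Polynomial.funext fun t => ?_⟩
    simp [hps, hg0]
  obtain ⟨r, hr⟩ := exists_polynomial_eq_of_continuous_quotient
    (continuous_finsetSum _ fun j _ => (hc j).mul (b j).continuous) _ g p hg0 rfl hps
  have hX : Polynomial.X ∣ r := by
    rw [Polynomial.X_dvd_iff, Polynomial.coeff_zero_eq_eval_zero, hr]
    simp [h0]
  obtain ⟨u, rfl⟩ := hX
  refine ⟨fun j => u * c j, ?_⟩
  have hpg : p = g * (Polynomial.X * u) := Polynomial.funext fun t => by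
    rw [Polynomial.eval_mul, hr, hps]
    simp
  rw [hpg, ← hcg, Finset.sum_mul]
  exact Finset.sum_congr rfl fun j _ => by ring

section Axes

variable {σ : Type*}

/-- Polynomials in the `i`-th variable as multivariate polynomials. -/
noncomputable def axisLift (i : σ) : Polynomial ℂ →ₐ[ℂ] MvPolynomial σ ℂ :=
  Polynomial.aeval (X i)

theorem axisLift_X_mul (i : σ) (p : Polynomial ℂ) :
    axisLift i (Polynomial.X * p) = X i * axisLift i p := by
  simp [axisLift]

/-- The ideal of the scheme of axes. -/
noncomputable def axesIdeal (σ : Type*) : Ideal (MvPolynomial σ ℂ) :=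
  Ideal.span {p | ∃ i j, i ≠ j ∧ p = X i * X j}

theorem X_mul_X_mem_axesIdeal {i j : σ} (h : i ≠ j) : X i * X j ∈ axesIdeal σ :=
  Ideal.subset_span ⟨i, j, h, rfl⟩

variable [DecidableEq σ]

/-- Restriction of polynomials to the `i`-th coordinate axis. -/
noncomputable def axisRestrict (i : σ) : MvPolynomial σ ℂ →ₐ[ℂ] Polynomial ℂ :=
  aeval (Pi.single i Polynomial.X)

theorem eval_axisRestrict (i : σ) (t : ℂ) (P : MvPolynomial σ ℂ) :
    (axisRestrict i P).eval t = eval (Pi.single i t) P := by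
  induction P using MvPolynomial.induction_on with
  | C a => simp [axisRestrict]
  | add p q hp hq => simp [hp, hq]
  | mul_X p j hp =>
    rw [map_mul, Polynomial.eval_mul, hp, map_mul, eval_X]
    congr 1
    by_cases hij : j = i
    · subst hij; simp [axisRestrict]
    · simp [axisRestrict, hij]

theorem axisRestrict_X_self (i : σ) : axisRestrict i (X i) = Polynomial.X := by
  simp [axisRestrict]

theorem axisRestrict_X_of_ne {i j : σ} (h : j ≠ i) : axisRestrict i (X j) = 0 := by
  simp [axisRestrict, h]

theorem axisRestrict_axisLift_self (i : σ) (p : Polynomial ℂ) :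
    axisRestrict i (axisLift i p) = p := by
  rw [axisLift, ← Polynomial.aeval_algHom_apply, axisRestrict_X_self,
    Polynomial.aeval_X_left_apply]

theorem X_mul_sub_mem_axesIdeal (i : σ) (P : MvPolynomial σ ℂ) :
    X i * (P - axisLift i (axisRestrict i P)) ∈ axesIdeal σ := by
  induction P using MvPolynomial.induction_on with
  | C a => simp [axisRestrict, axisLift, MvPolynomial.algebraMap_eq]
  | add p q hp hq =>
    have := add_mem hp hq
    simp only [map_add]
    convert this using 1
    ring
  | mul_X p j hp =>
    by_cases hij : j = i
    · subst hij
      rw [map_mul, axisRestrict_X_self, mul_comm (axisRestrict j p), axisLift_X_mul]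
      convert Ideal.mul_mem_right (X j) _ hp using 1
      ring
    · rw [map_mul, axisRestrict_X_of_ne hij, mul_zero, map_zero, sub_zero]
      convert Ideal.mul_mem_right p _ (X_mul_X_mem_axesIdeal (Ne.symm hij)) using 1
      ring

theorem sub_sum_axisLift_mem_axesIdeal [Fintype σ] (P : MvPolynomial σ ℂ) :
    P - C (eval 0 P) - ∑ i, (axisLift i (axisRestrict i P) - C (eval 0 P)) ∈ axesIdeal σ := by
  induction P using MvPolynomial.induction_on with
  | C a => simp [axisRestrict, axisLift, MvPolynomial.algebraMap_eq]
  | add p q hp hq =>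
    have := add_mem hp hq
    simp only [map_add]
    convert this using 1
    simp only [Finset.sum_sub_distrib, Finset.sum_add_distrib]
    ring
  | mul_X p j hp =>
    have hsum : ∑ i, axisLift i (axisRestrict i (p * X j)) =
        X j * axisLift j (axisRestrict j p) := by
      rw [Finset.sum_eq_single j]
      · rw [map_mul, axisRestrict_X_self, mul_comm, axisLift_X_mul]
      · intro i _ hij
        rw [map_mul, axisRestrict_X_of_ne hij.symm, mul_zero, map_zero]
      · simp
    have h0 : eval 0 (p * X j) = (0 : ℂ) := by simp
    simp only [h0, map_zero, sub_zero, hsum]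
    convert X_mul_sub_mem_axesIdeal j p using 1
    ring

/-- A polynomial vanishing at the origin and on all axes lies in the ideal of the axes. -/
theorem mem_axesIdeal_of_axisRestrict_eq_zero [Fintype σ] {P : MvPolynomial σ ℂ}
    (h0 : eval 0 P = 0) (h : ∀ i, axisRestrict i P = 0) : P ∈ axesIdeal σ := by
  have := sub_sum_axisLift_mem_axesIdeal P
  simp only [h0, h, map_zero, sub_zero, Finset.sum_const_zero] at this
  exact this

end Axes

/-- Let `X_n ⊆ ℂ^n` be the union of the coordinate axes. If `f, f_1, …, f_k ∈ ℂ[x_1,…,x_n]`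
and `f = Σ q_i f_i` on `X_n` for continuous functions `q_i : X_n → ℂ`, then `f` belongs to
the ideal `(f_1,…,f_k) + (x_i x_j : i ≠ j)`. -/
theorem stmt_10 (n k : ℕ) (f : MvPolynomial (Fin n) ℂ) (F : Fin k → MvPolynomial (Fin n) ℂ)
    (hq : ∃ q : Fin k → ({z : Fin n → ℂ // ∀ i j, i ≠ j → z i * z j = 0} → ℂ),
      (∀ i, Continuous (q i)) ∧
      ∀ z : {z : Fin n → ℂ // ∀ i j, i ≠ j → z i * z j = 0},
        eval z.1 f = ∑ i, q i z * eval z.1 (F i)) :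
    f ∈ Ideal.span (Set.range F) +
      Ideal.span {p : MvPolynomial (Fin n) ℂ | ∃ i j, i ≠ j ∧ p = X i * X j} := by
  obtain ⟨q, hqc, hq⟩ := hq
  have hmem : ∀ (i : Fin n) (t : ℂ), ∀ a b, a ≠ b →
      (Pi.single i t : Fin n → ℂ) a * (Pi.single i t : Fin n → ℂ) b = 0 := by
    intro i t a b hab
    by_cases ha : a = i
    · have hb : b ≠ i := fun hb => hab (ha.trans hb.symm)
      simp [hb]
    · simp [ha]
  let o : {z : Fin n → ℂ // ∀ i j, i ≠ j → z i * z j = 0} := ⟨0, by simp⟩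
  let f' : MvPolynomial (Fin n) ℂ := f - ∑ j, C (q j o) * F j
  have hf_zero : eval 0 f' = 0 := by
    have := hq o
    simp only [f', map_sub, map_sum, map_mul, eval_C]
    exact sub_eq_zero.2 this
  have haxis : ∀ i, ∃ a : Fin k → Polynomial ℂ,
      axisRestrict i f' = ∑ j, Polynomial.X * a j * axisRestrict i (F j) := by
    intro i
    refine exists_polynomial_coeffs _ _ (fun j t => q j ⟨Pi.single i t, hmem i t⟩ - q j o)
      (fun j => ?_) (fun j => ?_) fun t => ?_
    · refine ((hqc j).comp (Continuous.subtype_mk ?_ _)).sub continuous_const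
      exact continuous_single (A := fun _ : Fin n => ℂ) i
    · simp [o]
    · have := hq ⟨Pi.single i t, hmem i t⟩
      rw [eval_axisRestrict]
      simp only [eval_axisRestrict, f', map_sub, map_sum, map_mul, eval_C, this, sub_mul,
        Finset.sum_sub_distrib]
  choose a ha using haxis
  let S : MvPolynomial (Fin n) ℂ := ∑ l, ∑ j, X l * axisLift l (a l j) * F j
  have hdiff : f' - S ∈ axesIdeal (Fin n) := by
    refine mem_axesIdeal_of_axisRestrict_eq_zero ?_ fun i => ?_
    · rw [map_sub, hf_zero]
      simp [S]
    · rw [map_sub, sub_eq_zero, ha, map_sum, Finset.sum_eq_single i]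
      · simp [axisRestrict_X_self, axisRestrict_axisLift_self]
      · intro l _ hl
        simp [axisRestrict_X_of_ne hl]
      · simp
  have hF : ∀ j, F j ∈ Ideal.span (Set.range F) := fun j => Ideal.subset_span ⟨j, rfl⟩
  have hS : S + ∑ j, C (q j o) * F j ∈ Ideal.span (Set.range F) :=
    add_mem (sum_mem fun l _ => sum_mem fun j _ => Ideal.mul_mem_left _ _ (hF j))
      (sum_mem fun j _ => Ideal.mul_mem_left _ _ (hF j))
  have hf : f = (S + ∑ j, C (q j o) * F j) + (f' - S) := by
    simp only [f']
    ring
  rw [hf]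
  exact Submodule.add_mem_sup hS hdiff
end

section
/- Let f, f_1,…,f_k ∈ ℂ[z_1,…,z_m] all be homogeneous polynomials of the same degree d. If there exist continuous functions q_1,…,q_k : ℂ^m → ℂ such that f(z) = q_1(z)f_1(z) + … + q_k(z)f_k(z) for all z ∈ ℂ^m, then f belongs to the ideal generated by f_1,…,f_k in ℂ[z_1,…,z_m] (equivalently, f is a ℂ-linear combination of f_1,…,f_k). -/
open MvPolynomial

/-- Evaluating a homogeneous polynomial of degree `d` at `t • z` scales its value by `t ^ d`. -/
theorem MvPolynomial.IsHomogeneous.eval_smul_eq {σ R : Type*} [CommSemiring R]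
    {p : MvPolynomial σ R} {d : ℕ} (hp : p.IsHomogeneous d) (t : R) (z : σ → R) :
    eval (t • z) p = t ^ d * eval z p := by
  rw [eval_eq, eval_eq, Finset.mul_sum]
  refine Finset.sum_congr rfl fun s hs => ?_
  have hdeg : ∑ i ∈ s.support, s i = d := by
    rw [← Finsupp.degree_apply, Finsupp.degree_eq_weight_one]
    exact hp (mem_support_iff.mp hs)
  simp only [Pi.smul_apply, smul_eq_mul, mul_pow, Finset.prod_mul_distrib,
    Finset.prod_pow_eq_pow_sum, hdeg]
  ring

/-- A continuous combination of homogeneous polynomials of degree `d` that is itself such a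
polynomial is a constant combination, with coefficients the values at the origin. -/
theorem eval_eq_sum_zero_mul_eval {σ ι : Type*} [Fintype ι] {d : ℕ} {f : MvPolynomial σ ℂ}
    {F : ι → MvPolynomial σ ℂ} (hf : f.IsHomogeneous d) (hF : ∀ i, (F i).IsHomogeneous d)
    {q : ι → (σ → ℂ) → ℂ} (hq : ∀ i, Continuous (q i))
    (h : ∀ z, eval z f = ∑ i, q i z * eval z (F i)) (z : σ → ℂ) :
    eval z f = ∑ i, q i 0 * eval z (F i) := by
  have hcont : Continuous fun t : ℂ => ∑ i, q i (t • z) * eval z (F i) := by fun_prop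
  have heq : Set.EqOn (fun _ : ℂ => eval z f) (fun t => ∑ i, q i (t • z) * eval z (F i))
      {0}ᶜ := by
    intro t ht
    refine mul_left_cancel₀ (pow_ne_zero d ht) ?_
    simp only
    rw [← hf.eval_smul_eq, h, Finset.mul_sum]
    refine Finset.sum_congr rfl fun i _ => ?_
    rw [(hF i).eval_smul_eq]
    ring
  simpa using congrFun (continuous_const.ext_on (dense_compl_singleton (0 : ℂ)) hcont heq) 0

/-- If `f, f_1,…,f_k ∈ ℂ[z_1,…,z_m]` are all homogeneous of the same degree `d` and
`f = Σ q_i f_i` holds on `ℂ^m` with continuous functions `q_i`, then `f` lies in the ideal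
generated by `f_1,…,f_k`. -/
theorem stmt_11 (m k d : ℕ) (f : MvPolynomial (Fin m) ℂ)
    (F : Fin k → MvPolynomial (Fin m) ℂ)
    (hf : f.IsHomogeneous d) (hF : ∀ i, (F i).IsHomogeneous d)
    (hq : ∃ q : Fin k → ((Fin m → ℂ) → ℂ), (∀ i, Continuous (q i)) ∧
      ∀ z : Fin m → ℂ, eval z f = ∑ i, q i z * eval z (F i)) :
    f ∈ Ideal.span (Set.range F) := by
  obtain ⟨q, hq, h⟩ := hq
  have hsum : f = ∑ i, C (q i 0) * F i := funext fun z => by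
    simpa using eval_eq_sum_zero_mul_eval hf hF hq h z
  rw [hsum]
  exact Ideal.sum_mem _ fun i _ =>
    Ideal.mul_mem_left _ _ (Ideal.subset_span (Set.mem_range_self i))
end

section
/- Let d ≥ 1 and let τ ∈ ℕ^m be a multi-index with τ_1 + … + τ_m = d, and suppose z^τ is not the only monomial of degree d (i.e. m ≥ 2 and d ≥ 1). Let f_1,…,f_k be an enumeration of all monomials of degree d in z_1,…,z_m other than z^τ. Then there do NOT exist continuous functions q_1,…,q_k : ℂ^m → ℂ with z^τ = q_1(z)f_1(z) + … + q_k(z)f_k(z) for all z ∈ ℂ^m. -/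
/-- If `z^τ` is a combination of monomials of the same degree with continuous coefficients, then
the coefficients may be replaced by their values at the origin. -/
theorem prod_pow_eq_sum_apply_zero {ι κ : Type*} [Fintype ι] [Fintype κ] {d : ℕ}
    {τ : ι → ℕ} (hτ : ∑ i, τ i = d) {e : κ → ι → ℕ} (he : ∀ k, ∑ i, e k i = d)
    {q : κ → (ι → ℂ) → ℂ} (hq : ∀ k, Continuous (q k))
    (h : ∀ z : ι → ℂ, ∏ i, z i ^ τ i = ∑ k, q k z * ∏ i, z i ^ e k i) (z : ι → ℂ) :
    ∏ i, z i ^ τ i = ∑ k, q k 0 * ∏ i, z i ^ e k i := by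
  have hcont : Continuous fun t : ℂ => ∑ k, q k (t • z) * ∏ i, z i ^ e k i :=
    continuous_finsetSum _ fun k _ =>
      ((hq k).comp (continuous_id.smul continuous_const)).mul continuous_const
  have hscale : ∀ (t : ℂ) (a : ι → ℕ), ∑ i, a i = d →
      ∏ i, (t • z) i ^ a i = t ^ d * ∏ i, z i ^ a i := by
    intro t a ha
    simp only [Pi.smul_apply, smul_eq_mul, mul_pow, Finset.prod_mul_distrib,
      Finset.prod_pow_eq_pow_sum, ha]
  have heq := Continuous.ext_on (dense_compl_singleton (0 : ℂ))
    (continuous_const (y := ∏ i, z i ^ τ i)) hcont (by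
      intro t ht
      have ht0 : t ^ d ≠ 0 := pow_ne_zero _ (by simpa using ht)
      apply mul_left_cancel₀ ht0
      have := h (t • z)
      rw [hscale t τ hτ] at this
      simp only [hscale t _ (he _)] at this
      rw [this, Finset.mul_sum]
      exact Finset.sum_congr rfl fun k _ => by ring)
  simpa using congrFun heq 0

/-- A monomial function over an infinite domain is not a linear combination of other monomial
functions. -/
theorem not_forall_prod_pow_eq_sum {R ι κ : Type*} [CommRing R] [IsDomain R] [Infinite R]
    [Fintype ι] [Fintype κ] {τ : ι → ℕ} {e : κ → ι → ℕ} (he : ∀ k, e k ≠ τ) (c : κ → R) :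
    ¬ ∀ z : ι → R, ∏ i, z i ^ τ i = ∑ k, c k * ∏ i, z i ^ e k i := by
  classical
  intro h
  have hp : MvPolynomial.monomial (Finsupp.equivFunOnFinite.symm τ) (1 : R) =
      ∑ k, MvPolynomial.monomial (Finsupp.equivFunOnFinite.symm (e k)) (c k) :=
    MvPolynomial.funext fun z => by
      simpa [MvPolynomial.eval_monomial, Finsupp.prod_fintype] using h z
  have hc := congrArg (MvPolynomial.coeff (Finsupp.equivFunOnFinite.symm τ)) hp
  simp [MvPolynomial.coeff_sum, MvPolynomial.coeff_monomial, he] at hc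


/-- Let `τ ∈ ℕ^m` with `|τ| = d`, `d ≥ 1`, `m ≥ 2`, and let the `f_i` be all monomials of
degree `d` other than `z^τ` (degree-`d` exponent vectors are encoded with entries in
`Fin (d+1)`, which is no restriction since each entry is at most `d`). Then there is no
family of continuous functions `q_σ : ℂ^m → ℂ` with `z^τ = Σ_σ q_σ(z)·z^σ` on `ℂ^m`. -/
theorem stmt_12 (m d : ℕ) (hm : 2 ≤ m) (hd : 1 ≤ d) (τ : Fin m → ℕ)
    (hτ : ∑ i, τ i = d) :
    ¬ ∃ q : {σ : Fin m → Fin (d + 1) // ∑ i, (σ i : ℕ) = d ∧ (fun i => (σ i : ℕ)) ≠ τ} →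
        ((Fin m → ℂ) → ℂ),
      (∀ σ, Continuous (q σ)) ∧
      ∀ z : Fin m → ℂ,
        ∏ i, z i ^ τ i =
          ∑ σ : {σ : Fin m → Fin (d + 1) // ∑ i, (σ i : ℕ) = d ∧ (fun i => (σ i : ℕ)) ≠ τ},
            q σ z * ∏ i, z i ^ ((σ : Fin m → Fin (d + 1)) i : ℕ) := by
  rintro ⟨q, hq, h⟩
  exact not_forall_prod_pow_eq_sum (fun σ => σ.2.2) (fun σ => q σ 0)
    (prod_pow_eq_sum_apply_zero hτ (fun σ => σ.2.1) hq h)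
end

section
/- Let δ_1,…,δ_m be positive integers and let φ : ℂ^m → ℂ^m be the continuous map φ(z_1,…,z_m) = (z_1^{δ_1},…,z_m^{δ_m}). Let f, f_1,…,f_k be continuous ℂ-valued functions on ℂ^m. Then f belongs to the ideal generated by f_1,…,f_k in the ring C(ℂ^m, ℂ) of continuous functions if and only if f∘φ belongs to the ideal generated by f_1∘φ,…,f_k∘φ in C(ℂ^m, ℂ). -/
/-- The `n`-th power map on `ℂ` is proper when `n ≠ 0`. -/
theorem isProperMap_complex_pow {n : ℕ} (hn : n ≠ 0) : IsProperMap fun z : ℂ => z ^ n := by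
  refine isProperMap_iff_tendsto_cocompact.2 ⟨continuous_pow n, ?_⟩
  rw [← Metric.cobounded_eq_cocompact, ← comap_norm_atTop, Filter.tendsto_comap_iff]
  have : (norm ∘ fun z : ℂ => z ^ n) = (fun x : ℝ => x ^ n) ∘ norm := by
    ext z; simp
  rw [this]
  exact (Filter.tendsto_pow_atTop hn).comp Filter.tendsto_comap

/-- The coordinatewise power map on `ℂ^m` is a quotient map. -/
theorem isQuotientMap_complex_piPow {ι : Type*} {δ : ι → ℕ} (hδ : ∀ i, δ i ≠ 0) :
    Topology.IsQuotientMap fun (z : ι → ℂ) i => z i ^ δ i := by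
  have hp : IsProperMap fun (z : ι → ℂ) i => z i ^ δ i :=
    IsProperMap.pi_map fun i => isProperMap_complex_pow (hδ i)
  refine hp.isClosedMap.isQuotientMap hp.continuous fun w => ?_
  choose z hz using fun i => IsAlgClosed.exists_pow_nat_eq (w i) (Nat.pos_of_ne_zero (hδ i))
  exact ⟨z, funext hz⟩

/-- Two elements of a field with the same `n`-th power differ by an `n`-th root of unity. -/
theorem exists_rootsOfUnity_mul_eq {K : Type*} [Field K] {n : ℕ} (hn : n ≠ 0) {a b : K}
    (h : a ^ n = b ^ n) : ∃ ζ : rootsOfUnity n K, a = (ζ : Kˣ) * b := by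
  rcases eq_or_ne b 0 with rfl | hb
  · exact ⟨1, by simpa [hn] using h⟩
  · have : NeZero n := ⟨hn⟩
    refine ⟨rootsOfUnity.mkOfPowEq (a / b) ?_, ?_⟩
    · rw [div_pow, h, div_self (pow_ne_zero n hb)]
    · simp [hb]

noncomputable instance fintypeRootsOfUnity {K : Type*} [Field K] {n : ℕ} [NeZero n] :
    Fintype (rootsOfUnity n K) :=
  Fintype.ofFinite _

/-- The average of `g` over the action of a product of groups of roots of unity. -/
noncomputable def rootsOfUnityAverage {m : ℕ} (δ : Fin m → ℕ) [∀ i, NeZero (δ i)]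
    (g : C(Fin m → ℂ, ℂ)) : C(Fin m → ℂ, ℂ) where
  toFun z := (Fintype.card (∀ i, rootsOfUnity (δ i) ℂ) : ℂ)⁻¹ *
    ∑ ζ : ∀ i, rootsOfUnity (δ i) ℂ, g fun i => ((ζ i : ℂˣ) : ℂ) * z i
  continuous_toFun := by fun_prop

theorem rootsOfUnityAverage_eq_of_pow_eq {m : ℕ} (δ : Fin m → ℕ) [∀ i, NeZero (δ i)]
    (g : C(Fin m → ℂ, ℂ)) {a b : Fin m → ℂ} (h : ∀ i, a i ^ δ i = b i ^ δ i) :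
    rootsOfUnityAverage δ g a = rootsOfUnityAverage δ g b := by
  choose η hη using fun i => exists_rootsOfUnity_mul_eq (NeZero.ne (δ i)) (h i)
  simp only [rootsOfUnityAverage, ContinuousMap.coe_mk]
  congr 1
  refine Fintype.sum_equiv (Equiv.mulRight η) _ _ fun ζ => ?_
  congr 1
  ext i
  simp [hη i, mul_assoc]

/-- Let `φ : ℂ^m → ℂ^m`, `φ(z) = (z_1^{δ_1},…,z_m^{δ_m})` with all `δ_i ≥ 1`, and let
`f, f_1,…,f_k ∈ C(ℂ^m, ℂ)`. Then `f ∈ (f_1,…,f_k)` in `C(ℂ^m, ℂ)` if and only if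
`f∘φ ∈ (f_1∘φ,…,f_k∘φ)` in `C(ℂ^m, ℂ)`. -/
theorem stmt_14 (m k : ℕ) (δ : Fin m → ℕ) (hδ : ∀ i, 0 < δ i)
    (φ : C(Fin m → ℂ, Fin m → ℂ)) (hφ : ∀ z i, φ z i = z i ^ δ i)
    (f : C(Fin m → ℂ, ℂ)) (F : Fin k → C(Fin m → ℂ, ℂ)) :
    f ∈ Ideal.span (Set.range F) ↔
      f.comp φ ∈ Ideal.span (Set.range fun i => (F i).comp φ) := by
  simp only [Ideal.mem_span_range_iff_exists_fun]
  constructor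
  · rintro ⟨c, rfl⟩
    exact ⟨fun i => (c i).comp φ, by ext z; simp⟩
  · rintro ⟨c, hc⟩
    have (i : Fin m) : NeZero (δ i) := ⟨(hδ i).ne'⟩
    have hq : Topology.IsQuotientMap φ := by
      convert isQuotientMap_complex_piPow fun i => (hδ i).ne' using 1
      ext z i
      exact hφ z i
    have hinv (j : Fin k) (a b : Fin m → ℂ) (hab : φ a = φ b) :
        rootsOfUnityAverage δ (c j) a = rootsOfUnityAverage δ (c j) b :=
      rootsOfUnityAverage_eq_of_pow_eq δ (c j) fun i => by rw [← hφ, ← hφ, hab]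
    refine ⟨fun j => hq.lift (rootsOfUnityAverage δ (c j)) (hinv j), ?_⟩
    ext w
    obtain ⟨z, rfl⟩ := hq.surjective w
    have hlift (j : Fin k) : hq.lift (rootsOfUnityAverage δ (c j)) (hinv j) (φ z) =
        rootsOfUnityAverage δ (c j) z :=
      DFunLike.congr_fun (hq.lift_comp (rootsOfUnityAverage δ (c j)) (hinv j)) z
    have hterm (ζ : ∀ i, rootsOfUnity (δ i) ℂ) :
        ∑ j, c j (fun i => ((ζ i : ℂˣ) : ℂ) * z i) * F j (φ z) = f (φ z) := by
      have hφζ : φ (fun i => ((ζ i : ℂˣ) : ℂ) * z i) = φ z := by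
        ext i
        have hζ : ((ζ i : ℂˣ) : ℂ) ^ δ i = 1 := (mem_rootsOfUnity' _ _).1 (ζ i).2
        rw [hφ, hφ, mul_pow, hζ, one_mul]
      simpa [hφζ] using DFunLike.congr_fun hc fun i => ((ζ i : ℂˣ) : ℂ) * z i
    simp only [ContinuousMap.sum_apply, ContinuousMap.mul_apply, hlift]
    simp only [rootsOfUnityAverage, ContinuousMap.coe_mk, mul_assoc, ← Finset.mul_sum,
      Finset.sum_mul]
    rw [Finset.sum_comm]
    simp only [hterm, Finset.sum_const, Finset.card_univ, nsmul_eq_mul]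
    exact inv_mul_cancel_left₀ (Nat.cast_ne_zero.2 Fintype.card_ne_zero) _
end

section
/- For every natural number n ≥ 2 one has (z w^2)^n ∈ (z^3, z^2 w, w^3)^n in ℂ[z,w], yet there do not exist continuous functions q_1, q_2, q_3 : ℂ^2 → ℂ with z w^2 = q_1(z,w)·z^3 + q_2(z,w)·z^2 w + q_3(z,w)·w^3 for all (z,w) ∈ ℂ^2. (Thus f^n ∈ I^n for all n ≥ 2 does not imply that f lies in the continuous closure of I.) -/
open MvPolynomial

/-- If `a ^ 2 ∈ I ^ 2` and `a ^ 3 ∈ I ^ 3`, then `a ^ n ∈ I ^ n` for all `n ≥ 2`. -/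
theorem Ideal.pow_mem_pow_of_sq_of_cube {R : Type*} [CommSemiring R] {I : Ideal R} {a : R}
    (h2 : a ^ 2 ∈ I ^ 2) (h3 : a ^ 3 ∈ I ^ 3) {n : ℕ} (hn : 2 ≤ n) : a ^ n ∈ I ^ n := by
  induction n using Nat.strong_induction_on with
  | _ n ih =>
    obtain rfl | rfl | h : n = 2 ∨ n = 3 ∨ 4 ≤ n := by omega
    · exact h2
    · exact h3
    · obtain ⟨m, rfl⟩ : ∃ m, n = m + 2 := ⟨n - 2, by omega⟩
      rw [pow_add, pow_add]
      exact Ideal.mul_mem_mul (ih m (by omega) (by omega)) h2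

/-- A representation of the cubic form `z w²` by `z³, z² w, w³` with continuous coefficients
remains valid when the coefficients are frozen at the origin. -/
theorem eq_of_continuous_coefficients {q₁ q₂ q₃ : ℂ × ℂ → ℂ}
    (h₁ : Continuous q₁) (h₂ : Continuous q₂) (h₃ : Continuous q₃)
    (h : ∀ z w : ℂ, z * w ^ 2 =
      q₁ (z, w) * z ^ 3 + q₂ (z, w) * z ^ 2 * w + q₃ (z, w) * w ^ 3) (z w : ℂ) :
    z * w ^ 2 = q₁ (0, 0) * z ^ 3 + q₂ (0, 0) * z ^ 2 * w + q₃ (0, 0) * w ^ 3 := by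
  have key : (fun _ : ℂ => z * w ^ 2) = fun t : ℂ =>
      q₁ (t * z, t * w) * z ^ 3 + q₂ (t * z, t * w) * z ^ 2 * w + q₃ (t * z, t * w) * w ^ 3 := by
    refine Continuous.ext_on (dense_compl_singleton (0 : ℂ)) (by fun_prop) (by fun_prop) ?_
    intro t ht
    refine mul_left_cancel₀ (pow_ne_zero 3 (show t ≠ 0 from ht)) ?_
    linear_combination h (t * z) (t * w)
  simpa using congrFun key 0

/-- For every `n ≥ 2` one has `(z w²)^n ∈ (z³, z² w, w³)^n` in `ℂ[z,w]`, yet there are no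
continuous functions `q_1, q_2, q_3 : ℂ² → ℂ` with
`z w² = q_1·z³ + q_2·z² w + q_3·w³` on `ℂ²`. -/
theorem stmt_17 :
    (∀ n : ℕ, 2 ≤ n →
      (X 0 * X 1 ^ 2 : MvPolynomial (Fin 2) ℂ) ^ n ∈
        (Ideal.span {(X 0 ^ 3 : MvPolynomial (Fin 2) ℂ), X 0 ^ 2 * X 1, X 1 ^ 3}) ^ n) ∧
    ¬ ∃ q₁ q₂ q₃ : ℂ × ℂ → ℂ, Continuous q₁ ∧ Continuous q₂ ∧ Continuous q₃ ∧
      ∀ z w : ℂ, z * w ^ 2 =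
        q₁ (z, w) * z ^ 3 + q₂ (z, w) * z ^ 2 * w + q₃ (z, w) * w ^ 3 := by
  refine ⟨fun n hn => ?_, ?_⟩
  · set I := Ideal.span {(X 0 ^ 3 : MvPolynomial (Fin 2) ℂ), X 0 ^ 2 * X 1, X 1 ^ 3}
    have ha : (X 0 ^ 3 : MvPolynomial (Fin 2) ℂ) ∈ I := Ideal.subset_span (by simp)
    have hb : (X 0 ^ 2 * X 1 : MvPolynomial (Fin 2) ℂ) ∈ I := Ideal.subset_span (by simp)
    have hc : (X 1 ^ 3 : MvPolynomial (Fin 2) ℂ) ∈ I := Ideal.subset_span (by simp)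
    refine Ideal.pow_mem_pow_of_sq_of_cube ?_ ?_ hn
    · rw [pow_two I]
      convert Ideal.mul_mem_mul hb hc using 1
      ring
    · rw [pow_succ I, pow_two I]
      convert Ideal.mul_mem_mul (Ideal.mul_mem_mul ha hc) hc using 1
      ring
  · rintro ⟨q₁, q₂, q₃, h₁, h₂, h₃, h⟩
    have key := eq_of_continuous_coefficients h₁ h₂ h₃ h
    have h10 := key 1 0
    have h01 := key 0 1
    have h11 := key 1 1
    have h12 := key 1 2
    have : (2 : ℂ) = 0 := by
      linear_combination h12 - 2 * h11 + h10 - 6 * h01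
    norm_num at this
end
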